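/- There exist finite stable configuration structures E and F (each with eight events, four labelled a and four labelled b, as in the paper's Example 9) such that E and F are hereditary weak history-preserving (HWH) equivalent — and hence weak history-preserving (WH) equivalent — but E and F are not history-preserving (H) equivalent, and hence not hereditary history-preserving (HH) equivalent. -/

import Mathlib

open scoped Classical

noncomputable section

namespace EILPaper

/-- A configuration structure over event type `E` and alphabet `Act`:
a family of finite sets of events (configurations) together with a labelling. -/
structure CS (E Act : Type) where
  Conf : Set (Finset E)
  label : E → Act

namespace CS

variable {E Act : Type}

/-- Causality order `d ≤_X e`. -/
def le (C : CS E Act) (X : Finset E) (d e : E) : Prop :=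
  ∀ Y ∈ C.Conf, Y ⊆ X → e ∈ Y → d ∈ Y

/-- Stability of a configuration structure. -/
structure Stable (C : CS E Act) : Prop where
  rooted : ∅ ∈ C.Conf
  connected : ∀ X ∈ C.Conf, X ≠ ∅ → ∃ e ∈ X, X.erase e ∈ C.Conf
  unionClosed : ∀ X ∈ C.Conf, ∀ Y ∈ C.Conf, ∀ Z ∈ C.Conf, X ∪ Y ⊆ Z → X ∪ Y ∈ C.Conf
  interClosed : ∀ X ∈ C.Conf, ∀ Y ∈ C.Conf, ∀ Z ∈ C.Conf, X ∪ Y ⊆ Z → X ∩ Y ∈ C.Conf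

/-- Single-event forward transition `X →^e X'`. -/
def TranE (C : CS E Act) (X X' : Finset E) (e : E) : Prop :=
  X ∈ C.Conf ∧ X' ∈ C.Conf ∧ X ⊆ X' ∧ X' \ X = {e}

/-- Label-indexed forward transition `X →^a X'`. -/
def TranA (C : CS E Act) (X X' : Finset E) (a : Act) : Prop :=
  ∃ e, C.TranE X X' e ∧ C.label e = a

/-- Reverse transition `X ⇝^e X'`. -/
def RTranE (C : CS E Act) (X X' : Finset E) (e : E) : Prop := C.TranE X' X e

/-- Reverse transition `X ⇝^a X'`. -/
def RTranA (C : CS E Act) (X X' : Finset E) (a : Act) : Prop := C.TranA X' X a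

/-- Image-finiteness with respect to forward transitions. -/
def ImageFinite (C : CS E Act) : Prop :=
  ∀ X ∈ C.Conf, ∀ a : Act, {X' | C.TranA X X' a}.Finite

/-- A configuration structure is finite if its set of configurations is finite. -/
def Finite (C : CS E Act) : Prop := C.Conf.Finite

/-- The events of a configuration structure. -/
def events (C : CS E Act) : Set E := {e | ∃ X ∈ C.Conf, e ∈ X}

end CS

variable {E E1 E2 E3 Id Act : Type}

/-- `f` is a label-preserving order isomorphism from configuration `X` of `C`
to configuration `Y` of `D`. -/
def IsIso (C : CS E1 Act) (D : CS E2 Act) (X : Finset E1) (Y : Finset E2)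
    (f : E1 → E2) : Prop :=
  (∀ e ∈ X, f e ∈ Y) ∧
  (∀ d ∈ X, ∀ e ∈ X, f d = f e → d = e) ∧
  (∀ e' ∈ Y, ∃ e ∈ X, f e = e') ∧
  (∀ e ∈ X, D.label (f e) = C.label e) ∧
  (∀ d ∈ X, ∀ e ∈ X, (C.le X d e ↔ D.le Y (f d) (f e)))

/-- `X ≅ Y`: the configurations are isomorphic. -/
def Isom (C : CS E1 Act) (D : CS E2 Act) (X : Finset E1) (Y : Finset E2) : Prop :=
  ∃ f, IsIso C D X Y f

/-- Formulas of Event Identifier Logic (EIL). -/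
inductive EIL (Id Act : Type) : Type
  | tt : EIL Id Act
  | neg : EIL Id Act → EIL Id Act
  | conj : EIL Id Act → EIL Id Act → EIL Id Act
  | fwd : Id → Act → EIL Id Act → EIL Id Act   -- forward diamond ⟨x:a⟩φ
  | decl : Id → Act → EIL Id Act → EIL Id Act  -- declaration (x:a)φ
  | rev : Id → EIL Id Act → EIL Id Act         -- reverse diamond ⟨x⟩φ

namespace EIL

/-- Free identifiers of a formula. -/
def fi : EIL Id Act → Set Id
  | .tt => ∅
  | .neg φ => φ.fi
  | .conj φ ψ => φ.fi ∪ ψ.fi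
  | .fwd x _ φ => φ.fi \ {x}
  | .decl x _ φ => φ.fi \ {x}
  | .rev x φ => φ.fi ∪ {x}

/-- A formula is closed if it has no free identifiers. -/
def Closed (φ : EIL Id Act) : Prop := φ.fi = ∅

end EIL

/-- `ρ` is a permissible environment for `φ` and `X`. -/
def Permissible (φ : EIL Id Act) (ρ : Id → Option E) (X : Finset E) : Prop :=
  ∀ x ∈ φ.fi, ∃ e ∈ X, ρ x = some e

/-- The satisfaction relation `C, X, ρ ⊨ φ`. -/
def Sat (C : CS E Act) : EIL Id Act → Finset E → (Id → Option E) → Prop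
  | .tt, _, _ => True
  | .neg φ, X, ρ => ¬ Sat C φ X ρ
  | .conj φ ψ, X, ρ => Sat C φ X ρ ∧ Sat C ψ X ρ
  | .fwd x a φ, X, ρ =>
      ∃ e X', C.TranE X X' e ∧ C.label e = a ∧
        Sat C φ X' (Function.update ρ x (some e))
  | .decl x a φ, X, ρ =>
      ∃ e ∈ X, C.label e = a ∧ Sat C φ X (Function.update ρ x (some e))
  | .rev x φ, X, ρ =>
      ∃ e X', C.RTranE X X' e ∧ ρ x = some e ∧ Permissible φ ρ X' ∧ Sat C φ X' ρ

/-- Satisfaction of a closed formula in a configuration: `C, X ⊨ φ`. -/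
def SatC (C : CS E Act) (φ : EIL Id Act) (X : Finset E) : Prop :=
  Sat C φ X fun _ => none

/-- Satisfaction of a closed formula by a structure: `C ⊨ φ`. -/
def SatS (C : CS E Act) (φ : EIL Id Act) : Prop := SatC C φ ∅

/-- The reverse-only sublogic EIL_ro. -/
inductive RO : EIL Id Act → Prop
  | tt : RO .tt
  | neg {φ} : RO φ → RO (.neg φ)
  | conj {φ ψ} : RO φ → RO ψ → RO (.conj φ ψ)
  | decl {x a φ} : RO φ → RO (.decl x a φ)
  | rev {x φ} : RO φ → RO (.rev x φ)

/-- The declaration-free reverse-only sublogic EIL_dfro. -/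
inductive DFRO : EIL Id Act → Prop
  | tt : DFRO .tt
  | neg {φ} : DFRO φ → DFRO (.neg φ)
  | conj {φ ψ} : DFRO φ → DFRO ψ → DFRO (.conj φ ψ)
  | rev {x φ} : DFRO φ → DFRO (.rev x φ)

/-- The sublogic EIL_h: no forward move may occur inside a reverse move. -/
inductive InH : EIL Id Act → Prop
  | tt : InH .tt
  | neg {φ} : InH φ → InH (.neg φ)
  | conj {φ ψ} : InH φ → InH ψ → InH (.conj φ ψ)
  | fwd {x a φ} : InH φ → InH (.fwd x a φ)
  | decl {x a φ} : InH φ → InH (.decl x a φ)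
  | ro {φ} : RO φ → InH φ

/-- The sublogic EIL_wh: all formulas are closed, reverse-only parts are closed. -/
inductive InWH : EIL Id Act → Prop
  | tt : InWH .tt
  | neg {φ} : InWH φ → InWH (.neg φ)
  | conj {φ ψ} : InWH φ → InWH ψ → InWH (.conj φ ψ)
  | fwd {x a φ} : InWH φ → x ∉ φ.fi → InWH (.fwd x a φ)
  | roClosed {φ} : RO φ → φ.Closed → InWH φ

/-- The sublogic EIL_hwh: forward diamonds only applied to closed formulas. -/
inductive InHWH : EIL Id Act → Prop
  | tt : InHWH .tt
  | neg {φ} : InHWH φ → InHWH (.neg φ)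
  | conj {φ ψ} : InHWH φ → InHWH ψ → InHWH (.conj φ ψ)
  | fwd {x a φ} : InHWH φ → φ.Closed → InHWH (.fwd x a φ)
  | decl {x a φ} : InHWH φ → InHWH (.decl x a φ)
  | rev {x φ} : InHWH φ → InHWH (.rev x φ)

/-- Logical equivalence of two structures with respect to a sublogic `L`. -/
def EquivL (L : EIL Id Act → Prop) (C : CS E1 Act) (D : CS E2 Act) : Prop :=
  ∀ φ : EIL Id Act, L φ → φ.Closed → (SatS C φ ↔ SatS D φ)

/-- Weak history-preserving bisimulation. -/
structure IsWHBisim (C : CS E1 Act) (D : CS E2 Act)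
    (R : Finset E1 → Finset E2 → Prop) : Prop where
  root : R ∅ ∅
  iso : ∀ X Y, R X Y → Isom C D X Y
  forth : ∀ X Y a X', R X Y → C.TranA X X' a → ∃ Y', D.TranA Y Y' a ∧ R X' Y'
  back : ∀ X Y a Y', R X Y → D.TranA Y Y' a → ∃ X', C.TranA X X' a ∧ R X' Y'

/-- History-preserving bisimulation. -/
structure IsHBisim (C : CS E1 Act) (D : CS E2 Act)
    (R : Finset E1 → Finset E2 → (E1 → E2) → Prop) : Prop where
  root : ∃ f, R ∅ ∅ f
  iso : ∀ X Y f, R X Y f → IsIso C D X Y f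
  forth : ∀ X Y f a X', R X Y f → C.TranA X X' a →
    ∃ Y' f', D.TranA Y Y' a ∧ R X' Y' f' ∧ ∀ e ∈ X, f' e = f e
  back : ∀ X Y f a Y', R X Y f → D.TranA Y Y' a →
    ∃ X' f', C.TranA X X' a ∧ R X' Y' f' ∧ ∀ e ∈ X, f' e = f e

/-- Hereditary history-preserving bisimulation. -/
structure IsHHBisim (C : CS E1 Act) (D : CS E2 Act)
    (R : Finset E1 → Finset E2 → (E1 → E2) → Prop)
    extends IsHBisim C D R : Prop where
  rforth : ∀ X Y f a X', R X Y f → C.RTranA X X' a →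
    ∃ Y' f', D.RTranA Y Y' a ∧ R X' Y' f' ∧ ∀ e ∈ X', f e = f' e
  rback : ∀ X Y f a Y', R X Y f → D.RTranA Y Y' a →
    ∃ X' f', C.RTranA X X' a ∧ R X' Y' f' ∧ ∀ e ∈ X', f e = f' e

/-- Hereditary weak history-preserving bisimulation. -/
structure IsHWHBisim (C : CS E1 Act) (D : CS E2 Act)
    (R : Finset E1 → Finset E2 → (E1 → E2) → Prop) : Prop where
  root : ∃ f, R ∅ ∅ f
  iso : ∀ X Y f, R X Y f → IsIso C D X Y f
  forth : ∀ X Y f a X', R X Y f → C.TranA X X' a →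
    ∃ Y' f', D.TranA Y Y' a ∧ R X' Y' f'
  back : ∀ X Y f a Y', R X Y f → D.TranA Y Y' a →
    ∃ X' f', C.TranA X X' a ∧ R X' Y' f'
  rforth : ∀ X Y f a X', R X Y f → C.RTranA X X' a →
    ∃ Y' f', D.RTranA Y Y' a ∧ R X' Y' f' ∧ ∀ e ∈ X', f e = f' e
  rback : ∀ X Y f a Y', R X Y f → D.RTranA Y Y' a →
    ∃ X' f', C.RTranA X X' a ∧ R X' Y' f' ∧ ∀ e ∈ X', f e = f' e

/-- WH equivalence. -/
def WHEquiv (C : CS E1 Act) (D : CS E2 Act) : Prop := ∃ R, IsWHBisim C D R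

/-- H equivalence. -/
def HEquiv (C : CS E1 Act) (D : CS E2 Act) : Prop := ∃ R, IsHBisim C D R

/-- HH equivalence. -/
def HHEquiv (C : CS E1 Act) (D : CS E2 Act) : Prop := ∃ R, IsHHBisim C D R

/-- HWH equivalence. -/
def HWHEquiv (C : CS E1 Act) (D : CS E2 Act) : Prop := ∃ R, IsHWHBisim C D R



namespace CS

variable {C : CS E Act} {X X' Z : Finset E} {d e x : E}

theorem tranE_iff : C.TranE X X' e ↔
    X ∈ C.Conf ∧ X' ∈ C.Conf ∧ e ∉ X ∧ ∀ d, d ∈ X' ↔ d = e ∨ d ∈ X := by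
  constructor
  · rintro ⟨h, h', hs, hd⟩
    have key : ∀ d, (d ∈ X' ∧ d ∉ X) ↔ d = e := fun d => by
      rw [← Finset.mem_sdiff, hd, Finset.mem_singleton]
    refine ⟨h, h', ((key e).2 rfl).2, fun d => ⟨fun hX' => ?_, ?_⟩⟩
    · by_cases hX : d ∈ X
      · exact Or.inr hX
      · exact Or.inl ((key d).1 ⟨hX', hX⟩)
    · rintro (rfl | hX)
      exacts [((key d).2 rfl).1, hs hX]
  · rintro ⟨h, h', he, hd⟩
    refine ⟨h, h', fun d hX => (hd d).2 (Or.inr hX), ?_⟩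
    ext d
    rw [Finset.mem_sdiff, hd, Finset.mem_singleton]
    constructor
    · rintro ⟨rfl | hX, hn⟩
      exacts [rfl, absurd hX hn]
    · rintro rfl
      exact ⟨Or.inl rfl, he⟩

theorem tranE_iff_erase :
    C.TranE X' X x ↔ x ∈ X ∧ X ∈ C.Conf ∧ X.erase x ∈ C.Conf ∧ X' = X.erase x := by
  rw [tranE_iff]
  constructor
  · rintro ⟨h', h, hx, hd⟩
    have : X' = X.erase x := by
      ext d
      rw [Finset.mem_erase, hd]
      constructor
      · exact fun h => ⟨fun hdx => hx (hdx ▸ h), Or.inr h⟩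
      · rintro ⟨hne, rfl | h⟩
        exacts [absurd rfl hne, h]
    exact ⟨(hd x).2 (Or.inl rfl), h, this ▸ h', this⟩
  · rintro ⟨hx, h, h', rfl⟩
    refine ⟨h', h, Finset.notMem_erase x X, fun d => ?_⟩
    by_cases hdx : d = x <;> simp [hdx, hx]

/-- Stability in terms of membership of events. -/
theorem Stable.of_mem (rooted : ∅ ∈ C.Conf)
    (connected : ∀ X ∈ C.Conf, X.Nonempty →
      ∃ e ∈ X, ∀ W : Finset E, (∀ d, d ∈ W ↔ d ≠ e ∧ d ∈ X) → W ∈ C.Conf)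
    (union : ∀ X ∈ C.Conf, ∀ Y ∈ C.Conf, ∀ Z ∈ C.Conf, (∀ d ∈ X, d ∈ Z) → (∀ d ∈ Y, d ∈ Z) →
      ∀ W : Finset E, (∀ d, d ∈ W ↔ d ∈ X ∨ d ∈ Y) → W ∈ C.Conf)
    (inter : ∀ X ∈ C.Conf, ∀ Y ∈ C.Conf,
      ∀ W : Finset E, (∀ d, d ∈ W ↔ d ∈ X ∧ d ∈ Y) → W ∈ C.Conf) : C.Stable where
  rooted := rooted
  connected X hX hne := by
    obtain ⟨e, he, h⟩ := connected X hX (Finset.nonempty_iff_ne_empty.2 hne)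
    exact ⟨e, he, h _ fun d => Finset.mem_erase⟩
  unionClosed X hX Y hY Z hZ hs := union X hX Y hY Z hZ
    (fun _ hd => hs (Finset.mem_union_left _ hd)) (fun _ hd => hs (Finset.mem_union_right _ hd))
    _ fun _ => Finset.mem_union
  interClosed X hX Y hY _ _ _ := inter X hX Y hY _ fun _ => Finset.mem_inter

/-- A finite set covered by configurations inside it and below a common configuration
is a configuration. -/
theorem Stable.mem_of_cover (hC : C.Stable) (hZ : Z ∈ C.Conf) (hX : X ⊆ Z)
    (hcov : ∀ d ∈ X, ∃ W ∈ C.Conf, W ⊆ X ∧ d ∈ W) : X ∈ C.Conf := by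
  suffices h : ∀ S ⊆ X, ∃ W ∈ C.Conf, W ⊆ X ∧ S ⊆ W by
    obtain ⟨W, hW, hWX, hXW⟩ := h X subset_rfl
    rwa [hXW.antisymm hWX]
  intro S
  induction S using Finset.induction_on with
  | empty => exact fun _ => ⟨∅, hC.rooted, by simp, by simp⟩
  | insert d S _ ih =>
    intro hS
    obtain ⟨V, hV, hVX, hSV⟩ := ih ((Finset.subset_insert d S).trans hS)
    obtain ⟨W, hW, hWX, hdW⟩ := hcov d (hS (Finset.mem_insert_self d S))
    refine ⟨W ∪ V, hC.unionClosed W hW V hV Z hZ ((Finset.union_subset hWX hVX).trans hX),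
      Finset.union_subset hWX hVX, fun x hx => ?_⟩
    rw [Finset.mem_union]
    rcases Finset.mem_insert.1 hx with rfl | hx
    exacts [Or.inl hdW, Or.inr (hSV hx)]

/-- An event can be undone exactly when it is maximal. -/
theorem Stable.erase_mem_iff (hC : C.Stable) (hX : X ∈ C.Conf) :
    X.erase x ∈ C.Conf ↔ ∀ d ∈ X, C.le X x d → d = x := by
  constructor
  · intro h d hd hle
    by_contra hne
    exact Finset.notMem_erase x X
      (hle _ h (Finset.erase_subset x X) (Finset.mem_erase.2 ⟨hne, hd⟩))
  · intro h
    refine hC.mem_of_cover hX (Finset.erase_subset x X) fun d hd => ?_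
    obtain ⟨hne, hdX⟩ := Finset.mem_erase.1 hd
    by_contra! hcon
    refine hne (h d hdX fun W hW hWX hdW => ?_)
    by_contra hxW
    exact hcon W hW (fun w hw => Finset.mem_erase.2 ⟨fun h => hxW (h ▸ hw), hWX hw⟩) hdW

/-- In a stable structure causality is inherited by subconfigurations. -/
theorem Stable.le_iff_of_subset (hC : C.Stable) (hX : X ∈ C.Conf) (hX' : X' ∈ C.Conf)
    (hs : X' ⊆ X) (he : e ∈ X') : C.le X' d e ↔ C.le X d e := by
  constructor
  · intro h Y hY hYX heY
    exact Finset.mem_of_mem_inter_left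
      (h _ (hC.interClosed Y hY X' hX' X hX (Finset.union_subset hYX hs))
        Finset.inter_subset_right (Finset.mem_inter.2 ⟨heY, he⟩))
  · exact fun h Y hY hYX' heY => h Y hY (hYX'.trans hs) heY

end CS

namespace IsIso

variable {C : CS E1 Act} {D : CS E2 Act} {X : Finset E1} {Y : Finset E2} {f : E1 → E2} {x : E1}

theorem erase_mem_iff (h : IsIso C D X Y f) (hC : C.Stable) (hD : D.Stable)
    (hX : X ∈ C.Conf) (hY : Y ∈ D.Conf) (hx : x ∈ X) :
    Y.erase (f x) ∈ D.Conf ↔ X.erase x ∈ C.Conf := by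
  obtain ⟨hmap, hinj, hsurj, -, hle⟩ := h
  rw [hC.erase_mem_iff hX, hD.erase_mem_iff hY]
  constructor
  · exact fun H d hd hxd => hinj d hd x hx (H (f d) (hmap d hd) ((hle x hx d hd).1 hxd))
  · intro H d' hd' hxd
    obtain ⟨d, hd, rfl⟩ := hsurj d' hd'
    rw [H d hd ((hle x hx d hd).2 hxd)]

theorem erase (h : IsIso C D X Y f) (hC : C.Stable) (hD : D.Stable)
    (hX : X ∈ C.Conf) (hY : Y ∈ D.Conf) (hx : x ∈ X) (hX' : X.erase x ∈ C.Conf) :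
    IsIso C D (X.erase x) (Y.erase (f x)) f := by
  have hY' := (h.erase_mem_iff hC hD hX hY hx).2 hX'
  obtain ⟨hmap, hinj, hsurj, hlab, hle⟩ := h
  have hmap' : ∀ e ∈ X.erase x, f e ∈ Y.erase (f x) := fun e he => by
    obtain ⟨hne, heX⟩ := Finset.mem_erase.1 he
    exact Finset.mem_erase.2 ⟨fun h => hne (hinj e heX x hx h), hmap e heX⟩
  have hsub := Finset.erase_subset x X
  refine ⟨hmap', fun d hd e he => hinj d (hsub hd) e (hsub he), fun e' he' => ?_,
    fun e he => hlab e (hsub he), fun d hd e he => ?_⟩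
  · obtain ⟨hne, heY⟩ := Finset.mem_erase.1 he'
    obtain ⟨e, he, rfl⟩ := hsurj e' heY
    exact ⟨e, Finset.mem_erase.2 ⟨fun h => hne (h ▸ rfl), he⟩, rfl⟩
  · rw [hC.le_iff_of_subset hX hX' hsub he,
      hD.le_iff_of_subset hY hY' (Finset.erase_subset _ Y) (hmap' e he)]
    exact hle d (hsub hd) e (hsub he)

theorem card_filter_label (h : IsIso C D X Y f) (a : Act) :
    (X.filter (C.label · = a)).card = (Y.filter (D.label · = a)).card := by
  obtain ⟨hmap, hinj, hsurj, hlab, -⟩ := h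
  refine Finset.card_bij (fun e _ => f e) ?_ ?_ ?_
  · intro e he
    rw [Finset.mem_filter] at he ⊢
    exact ⟨hmap e he.1, (hlab e he.1).trans he.2⟩
  · intro d hd e he
    exact hinj d (Finset.mem_filter.1 hd).1 e (Finset.mem_filter.1 he).1
  · intro e' he'
    obtain ⟨he'Y, rfl⟩ := Finset.mem_filter.1 he'
    obtain ⟨e, he, rfl⟩ := hsurj e' he'Y
    exact ⟨e, Finset.mem_filter.2 ⟨he, (hlab e he).symm⟩, rfl⟩

end IsIso

/-- If label-isomorphic configurations enable the same labels with isomorphic results, then all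
isomorphisms between configurations of stable structures form an HWH bisimulation. -/
theorem isHWHBisim_of_isom {C : CS E1 Act} {D : CS E2 Act} (hC : C.Stable) (hD : D.Stable)
    (forth : ∀ X ∈ C.Conf, ∀ Y ∈ D.Conf, ∀ a X', Isom C D X Y → C.TranA X X' a →
      ∃ Y', D.TranA Y Y' a ∧ Isom C D X' Y')
    (back : ∀ X ∈ C.Conf, ∀ Y ∈ D.Conf, ∀ a Y', Isom C D X Y → D.TranA Y Y' a →
      ∃ X', C.TranA X X' a ∧ Isom C D X' Y')
    (root : Isom C D ∅ ∅) :
    IsHWHBisim C D fun X Y f => X ∈ C.Conf ∧ Y ∈ D.Conf ∧ IsIso C D X Y f where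
  root := root.imp fun _ h => ⟨hC.rooted, hD.rooted, h⟩
  iso _ _ _ h := h.2.2
  forth := by
    rintro X Y f a X' ⟨hX, hY, hf⟩ hXX'
    obtain ⟨Y', hYY', f', hf'⟩ := forth X hX Y hY a X' ⟨f, hf⟩ hXX'
    exact ⟨Y', f', hYY', hXX'.choose_spec.1.2.1, hYY'.choose_spec.1.2.1, hf'⟩
  back := by
    rintro X Y f a Y' ⟨hX, hY, hf⟩ hYY'
    obtain ⟨X', hXX', f', hf'⟩ := back X hX Y hY a Y' ⟨f, hf⟩ hYY'
    exact ⟨X', f', hXX', hXX'.choose_spec.1.2.1, hYY'.choose_spec.1.2.1, hf'⟩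
  rforth := by
    rintro X Y f a X' ⟨hX, hY, hf⟩ ⟨x, hx, rfl⟩
    obtain ⟨hxX, -, hX', rfl⟩ := CS.tranE_iff_erase.1 hx
    have hY' := (hf.erase_mem_iff hC hD hX hY hxX).2 hX'
    exact ⟨Y.erase (f x), f,
      ⟨f x, CS.tranE_iff_erase.2 ⟨hf.1 x hxX, hY, hY', rfl⟩, hf.2.2.2.1 x hxX⟩,
      ⟨hX', hY', hf.erase hC hD hX hY hxX hX'⟩, fun _ _ => rfl⟩
  rback := by
    rintro X Y f a Y' ⟨hX, hY, hf⟩ ⟨y, hy, rfl⟩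
    obtain ⟨hyY, -, hY', rfl⟩ := CS.tranE_iff_erase.1 hy
    obtain ⟨x, hxX, rfl⟩ := hf.2.2.1 y hyY
    have hX' := (hf.erase_mem_iff hC hD hX hY hxX).1 hY'
    exact ⟨X.erase x, f,
      ⟨x, CS.tranE_iff_erase.2 ⟨hxX, hX, hX', rfl⟩, (hf.2.2.2.1 x hxX).symm⟩,
      ⟨hX', hY', hf.erase hC hD hX hY hxX hX'⟩, fun _ _ => rfl⟩

theorem HWHEquiv.whEquiv {C : CS E1 Act} {D : CS E2 Act} : HWHEquiv C D → WHEquiv C D := by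
  rintro ⟨R, hR⟩
  refine ⟨fun X Y => ∃ f, R X Y f, hR.root, fun X Y ⟨f, hf⟩ => ⟨f, hR.iso X Y f hf⟩, ?_, ?_⟩
  · rintro X Y a X' ⟨f, hf⟩ h
    obtain ⟨Y', f', hY', hR'⟩ := hR.forth X Y f a X' hf h
    exact ⟨Y', hY', f', hR'⟩
  · rintro X Y a Y' ⟨f, hf⟩ h
    obtain ⟨X', f', hX', hR'⟩ := hR.back X Y f a Y' hf h
    exact ⟨X', hX', f', hR'⟩

theorem HHEquiv.hEquiv {C : CS E1 Act} {D : CS E2 Act} : HHEquiv C D → HEquiv C D :=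
  fun ⟨R, hR⟩ => ⟨R, hR.toIsHBisim⟩

/-- The configurations of the structure determined by a map `s`: each event `(false, i)` is
caused by `(true, i)`, two distinct events `(true, i)`, `(true, j)` are compatible iff `j = s i`
or `i = s j`, and `(false, i)` is compatible with `(true, j)`, for `j ≠ i`, iff `j = s i`. -/
def IsArrowConf {I : Type} (s : I → I) (X : Finset (Bool × I)) : Prop :=
  (∀ i, (false, i) ∈ X → (true, i) ∈ X) ∧
  (∀ i j, (true, i) ∈ X → (true, j) ∈ X → i = j ∨ j = s i ∨ i = s j) ∧
  (∀ i j, (false, i) ∈ X → (true, j) ∈ X → i = j ∨ j = s i) ∧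
  (∀ i j, (false, i) ∈ X → (false, j) ∈ X → i = j)

set_option synthInstance.maxSize 1000 in
instance {I : Type} [Fintype I] [DecidableEq I] (s : I → I) : DecidablePred (IsArrowConf s) :=
  fun X => by unfold IsArrowConf; infer_instance

/-- The configuration structure with configurations `IsArrowConf s`, labelled by the
Boolean component. -/
def arrowCS {I : Type} (s : I → I) : CS (Bool × I) Bool where
  Conf := {X | IsArrowConf s X}
  label := Prod.fst

section Arrow

variable {I : Type} {s t : I → I} {X X' : Finset (Bool × I)}

theorem isArrowConf_of_subset (hX : IsArrowConf s X) (hs : X' ⊆ X)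
    (hdown : ∀ i, (false, i) ∈ X' → (true, i) ∈ X') : IsArrowConf s X' :=
  ⟨hdown, fun i j hi hj => hX.2.1 i j (hs hi) (hs hj),
    fun i j hi hj => hX.2.2.1 i j (hs hi) (hs hj), fun i j hi hj => hX.2.2.2 i j (hs hi) (hs hj)⟩

theorem arrowCS_stable (s : I → I) : (arrowCS s).Stable := by
  refine CS.Stable.of_mem (by simp [arrowCS, IsArrowConf]) (fun X hX hne => ?_)
    (fun X hX Y hY Z hZ hXZ hYZ W hW => ?_) (fun X hX Y hY W hW => ?_)
  · by_cases h : ∃ i, (false, i) ∈ X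
    · obtain ⟨i, hi⟩ := h
      refine ⟨_, hi, fun W hW => isArrowConf_of_subset hX (fun d hd => ((hW d).1 hd).2)
        fun j hj => (hW _).2 ⟨by simp, hX.1 j ((hW _).1 hj).2⟩⟩
    · obtain ⟨e, he⟩ := hne
      exact ⟨e, he, fun W hW => isArrowConf_of_subset hX (fun d hd => ((hW d).1 hd).2)
        fun j hj => absurd ⟨j, ((hW _).1 hj).2⟩ h⟩
  · exact isArrowConf_of_subset hZ (fun d hd => ((hW d).1 hd).elim (hXZ d) (hYZ d))
      fun i hi => (hW _).2 (((hW _).1 hi).imp (hX.1 i) (hY.1 i))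
  · exact isArrowConf_of_subset hX (fun d hd => ((hW d).1 hd).1)
      fun i hi => (hW _).2 (((hW _).1 hi).imp (hX.1 i) (hY.1 i))

theorem arrowCS_le_iff (hX : IsArrowConf s X) {d e : Bool × I} (he : e ∈ X) :
    (arrowCS s).le X d e ↔ d = e ∨ d = (true, e.2) := by
  obtain ⟨b, i⟩ := e
  have hi : (true, i) ∈ X := by cases b; exacts [hX.1 i he, he]
  constructor
  · intro h
    have hsub : ({(b, i), (true, i)} : Finset (Bool × I)) ⊆ X := fun x hx => by
      simp only [Finset.mem_insert, Finset.mem_singleton] at hx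
      rcases hx with rfl | rfl <;> assumption
    have := h {(b, i), (true, i)} (isArrowConf_of_subset hX hsub fun j hj => by
      simp_all) hsub (by simp)
    simpa using this
  · rintro (rfl | rfl) Y hY hYX heY
    · exact heY
    · cases b
      exacts [hY.1 i heY, heY]

theorem arrowCS_finite [Finite I] (s : I → I) : (arrowCS s).Finite :=
  Set.toFinite _

theorem arrowCS_events (s : I → I) : (arrowCS s).events = Set.univ := by
  refine Set.eq_univ_of_forall fun ⟨b, i⟩ => ⟨{(true, i), (b, i)}, ?_, by simp⟩
  cases b <;> simp [arrowCS, IsArrowConf]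

theorem arrowCS_isIso_map (hX : IsArrowConf s X) {Y : Finset (Bool × I)} (hY : IsArrowConf t Y)
    (σ : Equiv.Perm I) (h : ∀ b i, (b, i) ∈ X ↔ (b, σ i) ∈ Y) :
    IsIso (arrowCS s) (arrowCS t) X Y (Prod.map id σ) := by
  refine ⟨fun e he => (h _ _).1 he, fun d _ e _ hde => ?_, fun e' he' => ?_, fun _ _ => rfl,
    fun d _ e he => ?_⟩
  · exact (Function.injective_id.prodMap σ.injective) hde
  · exact ⟨(e'.1, σ.symm e'.2), (h _ _).2 (by simpa using he'), by simp⟩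
  · rw [arrowCS_le_iff hX he, arrowCS_le_iff hY (e := Prod.map id σ e) ((h _ _).1 he)]
    simp [Prod.ext_iff]

end Arrow

/-- The fixed-point free maps on four points: two transpositions, or a four-cycle. -/
def twist (c : Bool) : Fin 4 → Fin 4 := if c then ![1, 2, 3, 0] else ![1, 0, 3, 2]

/-- The number of events of `X` with label `a`. -/
def labelCount (X : Finset (Bool × Fin 4)) (a : Bool) : ℕ := (X.filter (·.1 = a)).card

theorem twist_ne (c : Bool) (i : Fin 4) : twist c i ≠ i := by
  revert c i; decide

set_option synthInstance.maxSize 1000 in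
theorem twist_conf_normal_form (c : Bool) (X : Finset (Bool × Fin 4))
    (hX : IsArrowConf (twist c) X) : ∃ i, ∀ b j, (b, j) ∈ X ↔
      (b = true ∧ j = i ∧ 1 ≤ labelCount X true) ∨
      (b = true ∧ j = twist c i ∧ 2 ≤ labelCount X true) ∨
      (b = false ∧ j = i ∧ 1 ≤ labelCount X false) := by
  revert c X; decide +kernel

set_option synthInstance.maxSize 1000 in
theorem twist_enabled_iff (c : Bool) (X : Finset (Bool × Fin 4))
    (hX : IsArrowConf (twist c) X) (a : Bool) :
    (∃ i, (a, i) ∉ X ∧ IsArrowConf (twist c) (insert (a, i) X)) ↔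
      (a = true ∧ labelCount X true ≤ 1) ∨
      (a = false ∧ 1 ≤ labelCount X true ∧ labelCount X false = 0) := by
  revert c X a; decide +kernel

theorem exists_perm_map_pair {I : Type} {i j k l : I} (hij : j ≠ i) (hkl : l ≠ k) :
    ∃ σ : Equiv.Perm I, σ i = k ∧ σ j = l := by
  refine ⟨(Equiv.swap i k).trans (Equiv.swap (Equiv.swap i k j) l), ?_, by simp⟩
  have : k ≠ Equiv.swap i k j := fun h => hij <| (Equiv.swap i k).injective (by simp [← h])
  simp [Equiv.swap_apply_of_ne_of_ne this hkl.symm]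

theorem twist_isom_iff (c c' : Bool) {X Y : Finset (Bool × Fin 4)}
    (hX : IsArrowConf (twist c) X) (hY : IsArrowConf (twist c') Y) :
    Isom (arrowCS (twist c)) (arrowCS (twist c')) X Y ↔
      ∀ a, labelCount X a = labelCount Y a := by
  constructor
  · rintro ⟨f, hf⟩ a
    unfold labelCount
    convert hf.card_filter_label a <;> rfl
  · intro h
    obtain ⟨i, hi⟩ := twist_conf_normal_form c X hX
    obtain ⟨j, hj⟩ := twist_conf_normal_form c' Y hY
    obtain ⟨σ, rfl, hσ⟩ := exists_perm_map_pair (twist_ne c i) (twist_ne c' j)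
    refine ⟨_, arrowCS_isIso_map hX hY σ fun b k => ?_⟩
    rw [hi, hj, ← hσ, σ.injective.eq_iff, σ.injective.eq_iff, h, h]

theorem arrowCS_tranA_iff {I : Type} [DecidableEq I] {s : I → I} {X X' : Finset (Bool × I)}
    {a : Bool} : (arrowCS s).TranA X X' a ↔
      IsArrowConf s X ∧ IsArrowConf s X' ∧ ∃ i, (a, i) ∉ X ∧ X' = insert (a, i) X := by
  simp only [CS.TranA, CS.tranE_iff, Finset.ext_iff, Finset.mem_insert]
  constructor
  · rintro ⟨⟨_, i⟩, ⟨hX, hX', hi, h⟩, rfl⟩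
    exact ⟨hX, hX', i, hi, h⟩
  · rintro ⟨hX, hX', i, hi, h⟩
    exact ⟨(a, i), ⟨hX, hX', hi, h⟩, rfl⟩

theorem labelCount_insert {X : Finset (Bool × Fin 4)} {a : Bool} {i : Fin 4} (h : (a, i) ∉ X)
    (b : Bool) : labelCount (insert (a, i) X) b = labelCount X b + if a = b then 1 else 0 := by
  unfold labelCount
  rw [Finset.filter_insert]
  split_ifs with hab
  · rw [Finset.card_insert_of_notMem (by simp [h])]
  · rfl

theorem twist_forth (c c' : Bool) {X Y X' : Finset (Bool × Fin 4)} {a : Bool}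
    (hY : IsArrowConf (twist c') Y) (h : ∀ b, labelCount X b = labelCount Y b)
    (hXX' : (arrowCS (twist c)).TranA X X' a) :
    ∃ Y', (arrowCS (twist c')).TranA Y Y' a ∧ ∀ b, labelCount X' b = labelCount Y' b := by
  obtain ⟨hX, hX', i, hi, rfl⟩ := arrowCS_tranA_iff.1 hXX'
  have henabled := (twist_enabled_iff c X hX a).1 ⟨i, hi, hX'⟩
  rw [h, h] at henabled
  obtain ⟨j, hj, hY'⟩ := (twist_enabled_iff c' Y hY a).2 henabled
  refine ⟨_, arrowCS_tranA_iff.2 ⟨hY, hY', j, hj, rfl⟩, fun b => ?_⟩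
  rw [labelCount_insert hi, labelCount_insert hj, h]

theorem twist_hwhEquiv (c c' : Bool) : HWHEquiv (arrowCS (twist c)) (arrowCS (twist c')) := by
  refine ⟨_, isHWHBisim_of_isom (arrowCS_stable _) (arrowCS_stable _) ?_ ?_ ?_⟩
  · intro X hX Y hY a X' hXY hXX'
    obtain ⟨Y', hYY', h⟩ := twist_forth c c' hY ((twist_isom_iff c c' hX hY).1 hXY) hXX'
    exact ⟨Y', hYY', (twist_isom_iff c c' (arrowCS_tranA_iff.1 hXX').2.1
      (arrowCS_tranA_iff.1 hYY').2.1).2 h⟩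
  · intro X hX Y hY a Y' hXY hYY'
    obtain ⟨X', hXX', h⟩ :=
      twist_forth c' c hX (fun b => ((twist_isom_iff c c' hX hY).1 hXY b).symm) hYY'
    exact ⟨X', hXX', (twist_isom_iff c c' (arrowCS_tranA_iff.1 hXX').2.1
      (arrowCS_tranA_iff.1 hYY').2.1).2 fun b => (h b).symm⟩
  · exact (twist_isom_iff c c' (arrowCS_stable _).rooted (arrowCS_stable _).rooted).2
      fun _ => rfl

/-- In an H bisimulation, an event matched against a forward transition extends the isomorphism,
and is labelled alike. -/
theorem IsHBisim.exists_arrow_match {I J : Type} [DecidableEq I] [DecidableEq J]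
    {s : I → I} {t : J → J}
    {R : Finset (Bool × I) → Finset (Bool × J) → (Bool × I → Bool × J) → Prop}
    (hR : IsHBisim (arrowCS s) (arrowCS t) R) {X : Finset (Bool × I)} {Y : Finset (Bool × J)}
    {f : Bool × I → Bool × J} (hf : R X Y f) (hX : IsArrowConf s X) {a : Bool} {i : I}
    (hi : (a, i) ∉ X) (hX' : IsArrowConf s (insert (a, i) X)) :
    ∃ j f', (a, j) ∉ Y ∧ IsArrowConf t (insert (a, j) Y) ∧
      R (insert (a, i) X) (insert (a, j) Y) f' ∧ f' (a, i) = (a, j) ∧ ∀ e ∈ X, f' e = f e := by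
  obtain ⟨Y', f', hYY', hR', hext⟩ :=
    hR.forth X Y f a _ hf (arrowCS_tranA_iff.2 ⟨hX, hX', i, hi, rfl⟩)
  obtain ⟨-, hY', j, hj, rfl⟩ := arrowCS_tranA_iff.1 hYY'
  refine ⟨j, f', hj, hY', hR', ?_, hext⟩
  obtain ⟨hmap, hinj, -⟩ := hR.iso _ _ _ hR'
  obtain ⟨-, -, hsurj, -⟩ := hR.iso _ _ _ hf
  refine (Finset.mem_insert.1 (hmap _ (Finset.mem_insert_self _ _))).resolve_right fun hmem => ?_
  obtain ⟨e, he, hfe⟩ := hsurj _ hmem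
  rw [← hext e he] at hfe
  exact hi (hinj e (Finset.mem_insert_of_mem he) _ (Finset.mem_insert_self _ _) hfe ▸ he)

/-- In an H bisimulation, if `(false, i)` can follow its cause `(true, i)`, then `(false, p)` can
follow the event `(true, p)` matched to `(true, i)`. -/
theorem IsHBisim.isArrowConf_insert_false {I J : Type} [DecidableEq I] [DecidableEq J]
    {s : I → I} {t : J → J}
    {R : Finset (Bool × I) → Finset (Bool × J) → (Bool × I → Bool × J) → Prop}
    (hR : IsHBisim (arrowCS s) (arrowCS t) R) {X : Finset (Bool × I)} {Y : Finset (Bool × J)}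
    {f : Bool × I → Bool × J} (hf : R X Y f) (hX : IsArrowConf s X) {i : I} {p : J}
    (hi : (true, i) ∈ X) (hp : f (true, i) = (true, p)) (hn : (false, i) ∉ X)
    (hX' : IsArrowConf s (insert (false, i) X)) : IsArrowConf t (insert (false, p) Y) := by
  obtain ⟨m, f', -, hY', hR', hm, hext⟩ := hR.exists_arrow_match hf hX hn hX'
  obtain ⟨hmap, -, -, -, hle⟩ := hR.iso _ _ _ hR'
  have hself := Finset.mem_insert_self (false, i) X
  have h := (hle _ (Finset.mem_insert_of_mem hi) _ hself).1
    ((arrowCS_le_iff hX' hself).2 (Or.inr rfl))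
  rw [arrowCS_le_iff hY' (hmap _ hself), hext _ hi, hp, hm] at h
  obtain rfl : p = m := by simpa using h
  exact hY'

theorem twist_not_hEquiv : ¬ HEquiv (arrowCS (twist false)) (arrowCS (twist true)) := by
  rintro ⟨R, hR⟩
  obtain ⟨f₀, h₀⟩ := hR.root
  obtain ⟨j, f₁, -, -, h₁, hf₁, -⟩ :=
    hR.exists_arrow_match h₀ (a := true) (i := 0) (by decide) (by decide) (by decide)
  obtain ⟨k, f₂, hk, -, h₂, hf₂, hext⟩ :=
    hR.exists_arrow_match h₁ (a := true) (i := 1) (by decide) (by decide) (by decide)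
  rw [← hext _ (Finset.mem_insert_self _ _)] at hf₁
  have hj := hR.isArrowConf_insert_false h₂ (by decide) (by decide) hf₁ (by decide) (by decide)
  have hk' := hR.isArrowConf_insert_false h₂ (by decide) (by decide) hf₂ (by decide) (by decide)
  clear * - hk hj hk'
  revert j k
  decide +kernel

/-- there exist finite stable configuration structures, each
with eight events (four labelled `a` = `true` and four labelled `b` = `false`),
that are HWH equivalent (hence WH equivalent) but not H equivalent (hence not
HH equivalent). -/
theorem stmt11 :
    ∃ (E1 E2 : Type) (C : CS E1 Bool) (D : CS E2 Bool),
      C.Stable ∧ C.Finite ∧ D.Stable ∧ D.Finite ∧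
      C.events.ncard = 8 ∧
      {e ∈ C.events | C.label e = true}.ncard = 4 ∧
      {e ∈ C.events | C.label e = false}.ncard = 4 ∧
      D.events.ncard = 8 ∧
      {e ∈ D.events | D.label e = true}.ncard = 4 ∧
      {e ∈ D.events | D.label e = false}.ncard = 4 ∧
      HWHEquiv C D ∧ WHEquiv C D ∧ ¬ HEquiv C D ∧ ¬ HHEquiv C D := by
  have hevents : {e : Bool × Fin 4 | e ∈ Set.univ}.ncard = 8 := by simp [Set.ncard_univ]
  have hlabel : ∀ a, {e : Bool × Fin 4 | e ∈ Set.univ ∧ e.1 = a}.ncard = 4 := fun a => by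
    rw [Set.ncard_eq_toFinset_card']
    revert a; decide
  refine ⟨_, _, arrowCS (twist false), arrowCS (twist true), arrowCS_stable _, arrowCS_finite _,
    arrowCS_stable _, arrowCS_finite _, ?_, ?_, ?_, ?_, ?_, ?_, twist_hwhEquiv _ _,
    (twist_hwhEquiv _ _).whEquiv, twist_not_hEquiv, fun h => twist_not_hEquiv h.hEquiv⟩
  all_goals rw [arrowCS_events]
  exacts [hevents, hlabel true, hlabel false, hevents, hlabel true, hlabel false]

end EILPaper
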